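/- Let G be a Young function satisfying p⁻ ≤ t·g(t)/G(t) ≤ p⁺ (1 < p⁻ ≤ p⁺), and M, N : (0,∞) → (0,∞) nondecreasing with M(r) ≥ min{1,r}, N continuous, ∫₀¹ r^{n−1+p⁻}/(N(r)M(r)^{p⁻}) dr < ∞ and ∫₁^∞ r^{n−1}/(N(r)M(r)^{p⁻}) dr < ∞. Then for every u ∈ C²_c(ℝⁿ) there is a constant C = C(G, M, N, n) such that ∬_{ℝ²ⁿ} G(|u(x)−u(y)|/M(|x−y|)) dx dy / N(|x−y|) ≤ C (∫_{ℝⁿ} G(|∇u|) dx + ∫_{ℝⁿ} G(|u|) dx). -/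

import Mathlib

open Real Set MeasureTheory ENNReal

/-- A Young function is nonnegative. -/
lemma young_nonneg (G : ℝ → ℝ) (hEven : ∀ t, G (-t) = G t)
    (hConv : ConvexOn ℝ univ G) (hG0 : G 0 = 0) (t : ℝ) : 0 ≤ G t := by
  have h := hConv.2 (mem_univ t) (mem_univ (-t)) (by norm_num : (0:ℝ) ≤ 1/2)
    (by norm_num : (0:ℝ) ≤ 1/2) (by norm_num)
  simp only [smul_eq_mul, hEven] at h
  have e : (1/2 * t + 1/2 * -t : ℝ) = 0 := by ring
  rw [e, hG0] at h
  linarith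

lemma young_mono (G : ℝ → ℝ) (hEven : ∀ t, G (-t) = G t)
    (hConv : ConvexOn ℝ univ G) (hMono : StrictMonoOn G (Ioi 0)) (hG0 : G 0 = 0)
    {s t : ℝ} (hs : 0 ≤ s) (hst : s ≤ t) : G s ≤ G t := by
  rcases hs.eq_or_lt with rfl | hs
  · rw [hG0]; exact young_nonneg G hEven hConv hG0 t
  · exact hMono.monotoneOn hs (hs.trans_le hst) hst

lemma young_cont (G : ℝ → ℝ) (hConv : ConvexOn ℝ univ G) : Continuous G := by
  rw [← continuousOn_univ]
  exact hConv.continuousOn isOpen_univ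

lemma young_pos (G : ℝ → ℝ) (hEven : ∀ t, G (-t) = G t)
    (hConv : ConvexOn ℝ univ G) (hMono : StrictMonoOn G (Ioi 0)) (hG0 : G 0 = 0)
    {t : ℝ} (ht : 0 < t) : 0 < G t := by
  have h1 := young_nonneg G hEven hConv hG0 (t/2)
  have h2 : G (t/2) < G t := hMono (by simpa using ht) ht (by linarith)
  linarith

lemma young_hasDeriv (G g : ℝ → ℝ) (hderiv : ∀ t > 0, HasDerivAt G (g t) t) (p : ℝ)
    {t : ℝ} (ht : 0 < t) :
    HasDerivAt (fun s => G s * s ^ (-p)) (t ^ (-p - 1) * (t * g t - p * G t)) t := by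
  have h := (hderiv t ht).mul (Real.hasDerivAt_rpow_const (p := -p) (Or.inl ht.ne'))
  convert! h using 1
  have : t ^ (-p) = t ^ (-p-1) * t := by
    rw [← Real.rpow_add_one ht.ne']; congr 1; ring
  rw [this]; ring

lemma young_scale_le (G g : ℝ → ℝ) (pm : ℝ)
    (hpos : ∀ t > 0, 0 < G t) (hG0 : G 0 = 0)
    (hderiv : ∀ t > 0, HasDerivAt G (g t) t)
    (hgrowth : ∀ t > 0, pm ≤ t * g t / G t) {c t : ℝ} (hc : 0 < c) (hc1 : c ≤ 1)
    (ht : 0 ≤ t) : G (c * t) ≤ c ^ pm * G t := by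
  rcases ht.eq_or_lt with rfl | ht
  · simp [hG0]
  have hm : MonotoneOn (fun s => G s * s ^ (-pm)) (Ioi 0) := by
    apply monotoneOn_of_deriv_nonneg (convex_Ioi 0)
    · intro x hx
      exact (young_hasDeriv G g hderiv pm hx).continuousAt.continuousWithinAt
    · rw [interior_Ioi]
      intro x hx
      exact (young_hasDeriv G g hderiv pm hx).differentiableAt.differentiableWithinAt
    · rw [interior_Ioi]
      intro x hx
      rw [(young_hasDeriv G g hderiv pm hx).deriv]
      have := (le_div_iff₀ (hpos x hx)).1 (hgrowth x hx)
      have h2 : 0 < x ^ (-pm - 1) := Real.rpow_pos_of_pos hx _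
      exact mul_nonneg h2.le (by linarith)
  have h := hm (a := c * t) (b := t) (mul_pos hc ht) ht (by nlinarith)
  simp only [Real.mul_rpow hc.le ht.le] at h
  have h3 : 0 < t ^ (-pm) := Real.rpow_pos_of_pos ht _
  have h4 : G (c*t) * c ^ (-pm) ≤ G t := by
    refine le_of_mul_le_mul_right ?_ h3
    linarith
  rw [Real.rpow_neg hc.le] at h4
  have h5 : 0 < c ^ pm := Real.rpow_pos_of_pos hc _
  rw [← div_eq_mul_inv, div_le_iff₀ h5] at h4
  linarith

lemma young_double (G g : ℝ → ℝ) (pp : ℝ)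
    (hpos : ∀ t > 0, 0 < G t) (hG0 : G 0 = 0)
    (hderiv : ∀ t > 0, HasDerivAt G (g t) t)
    (hgrowth : ∀ t > 0, t * g t / G t ≤ pp) {t : ℝ}
    (ht : 0 ≤ t) : G (2 * t) ≤ 2 ^ pp * G t := by
  rcases ht.eq_or_lt with rfl | ht
  · simp [hG0]
  have hm : AntitoneOn (fun s => G s * s ^ (-pp)) (Ioi 0) := by
    apply antitoneOn_of_deriv_nonpos (convex_Ioi 0)
    · intro x hx
      exact (young_hasDeriv G g hderiv pp hx).continuousAt.continuousWithinAt
    · rw [interior_Ioi]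
      intro x hx
      exact (young_hasDeriv G g hderiv pp hx).differentiableAt.differentiableWithinAt
    · rw [interior_Ioi]
      intro x hx
      rw [(young_hasDeriv G g hderiv pp hx).deriv]
      have := (div_le_iff₀ (hpos x hx)).1 (hgrowth x hx)
      have h2 : 0 < x ^ (-pp - 1) := Real.rpow_pos_of_pos hx _
      exact mul_nonpos_of_nonneg_of_nonpos h2.le (by linarith)
  have h := hm (a := t) (b := 2 * t) ht (by simpa using ht) (by linarith)
  simp only [Real.mul_rpow zero_le_two ht.le] at h
  have h3 : 0 < t ^ (-pp) := Real.rpow_pos_of_pos ht _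
  have h4 : G (2*t) * 2 ^ (-pp) ≤ G t := by
    refine le_of_mul_le_mul_right ?_ h3
    linarith
  rw [Real.rpow_neg zero_le_two] at h4
  have h5 : (0:ℝ) < 2 ^ pp := Real.rpow_pos_of_pos two_pos _
  rw [← div_eq_mul_inv, div_le_iff₀ h5] at h4
  linarith

/-- Pointwise Jensen bound for difference quotients. -/
lemma diff_quot_jensen {E : Type*} [NormedAddCommGroup E] [NormedSpace ℝ E]
    (G : ℝ → ℝ) (hnn : ∀ t, 0 ≤ G t)
    (hmono : ∀ s t, 0 ≤ s → s ≤ t → G s ≤ G t)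
    (hConv : ConvexOn ℝ univ G) (hc : Continuous G)
    (u : E → ℝ) (hu : ContDiff ℝ 2 u) (x h : E) (hh : h ≠ 0) :
    ENNReal.ofReal (G (|u (x + h) - u x| / ‖h‖)) ≤
      ∫⁻ t in Ioc (0:ℝ) 1, ENNReal.ofReal (G ‖fderiv ℝ u (x + t • h)‖) := by
  have hfc : Continuous (fun t : ℝ => fderiv ℝ u (x + t • h)) :=
    (hu.continuous_fderiv (by norm_num)).comp (by fun_prop)
  have hd : ∀ t : ℝ, HasDerivAt (fun t : ℝ => u (x + t • h)) (fderiv ℝ u (x + t • h) h) t := by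
    intro t
    have h1 : HasDerivAt (fun t : ℝ => x + t • h) h t := by
      simpa using ((hasDerivAt_id t).smul_const h).const_add x
    exact ((hu.differentiable (by norm_num)) _).hasFDerivAt.comp_hasDerivAt t h1
  have hftc := intervalIntegral.integral_eq_sub_of_hasDerivAt (a := 0) (b := 1)
    (fun t _ => hd t) ((hfc.clm_apply continuous_const).intervalIntegrable _ _)
  simp only [one_smul, zero_smul, add_zero] at hftc
  have hhn : 0 < ‖h‖ := norm_pos_iff.2 hh
  have hle : |u (x + h) - u x| / ‖h‖ ≤ ∫ t in Ioc (0:ℝ) 1, ‖fderiv ℝ u (x + t • h)‖ := by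
    rw [div_le_iff₀ hhn, ← hftc, ← Real.norm_eq_abs,
      intervalIntegral.integral_of_le zero_le_one, ← integral_mul_const]
    refine norm_integral_le_of_norm_le ?_ (Filter.Eventually.of_forall fun t => ?_)
    · exact ((hfc.norm.mul continuous_const).integrableOn_Icc).mono_set Ioc_subset_Icc_self
    · exact ContinuousLinearMap.le_opNorm _ _
  have hi : IntegrableOn (fun t : ℝ => ‖fderiv ℝ u (x + t • h)‖) (Ioc 0 1) :=
    (hfc.norm.integrableOn_Icc).mono_set Ioc_subset_Icc_self
  have hGi : IntegrableOn (fun t : ℝ => G ‖fderiv ℝ u (x + t • h)‖) (Ioc 0 1) :=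
    ((hc.comp hfc.norm).integrableOn_Icc).mono_set Ioc_subset_Icc_self
  have : IsProbabilityMeasure (volume.restrict (Ioc (0:ℝ) 1)) := ⟨by simp⟩
  have hJ := hConv.map_integral_le (μ := volume.restrict (Ioc (0:ℝ) 1)) hc.continuousOn
    isClosed_univ (by simp) hi hGi
  rw [← ofReal_integral_eq_lintegral_ofReal hGi (Filter.Eventually.of_forall fun t => hnn _)]
  exact ENNReal.ofReal_le_ofReal ((hmono _ _ (by positivity) hle).trans hJ)

lemma translation_bound {n : ℕ}
    (G : ℝ → ℝ) (hnn : ∀ t, 0 ≤ G t)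
    (hmono : ∀ s t, 0 ≤ s → s ≤ t → G s ≤ G t)
    (hConv : ConvexOn ℝ univ G) (hc : Continuous G) (K : ℝ) (hK : 1 ≤ K)
    (hdbl : ∀ t, 0 ≤ t → G (2 * t) ≤ K * G t)
    (u : EuclideanSpace ℝ (Fin n) → ℝ) (hu : ContDiff ℝ 2 u)
    (h : EuclideanSpace ℝ (Fin n)) (hh : h ≠ 0) :
    ∫⁻ x, ENNReal.ofReal (G (|u (x + h) - u x| / min 1 ‖h‖)) ≤
      ENNReal.ofReal K * ((∫⁻ x, ENNReal.ofReal (G ‖fderiv ℝ u x‖)) +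
          ∫⁻ x, ENNReal.ofReal (G |u x|)) := by
  have hK0 : 0 ≤ K := zero_le_one.trans hK
  have hKK : (1:ℝ≥0∞) ≤ ENNReal.ofReal K := by simpa using hK
  have hfd : Continuous (fderiv ℝ u) := hu.continuous_fderiv (by norm_num)
  have huc : Continuous u := hu.continuous
  rcases le_total ‖h‖ 1 with h1 | h1
  · rw [min_eq_right h1]
    calc _ ≤ ∫⁻ x, ∫⁻ t in Ioc (0:ℝ) 1, ENNReal.ofReal (G ‖fderiv ℝ u (x + t • h)‖) :=
          lintegral_mono fun x => diff_quot_jensen G hnn hmono hConv hc u hu x h hh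
      _ = ∫⁻ t in Ioc (0:ℝ) 1, ∫⁻ x, ENNReal.ofReal (G ‖fderiv ℝ u (x + t • h)‖) := by
          apply lintegral_lintegral_swap
          apply Measurable.aemeasurable
          apply ENNReal.measurable_ofReal.comp
          apply Continuous.measurable
          apply hc.comp
          apply Continuous.norm
          apply hfd.comp
          fun_prop
      _ = ∫⁻ x, ENNReal.ofReal (G ‖fderiv ℝ u x‖) := by
          have e : ∀ t : ℝ, ∫⁻ x, ENNReal.ofReal (G ‖fderiv ℝ u (x + t • h)‖) =
              ∫⁻ x, ENNReal.ofReal (G ‖fderiv ℝ u x‖) := fun t =>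
            lintegral_add_right_eq_self (fun x => ENNReal.ofReal (G ‖fderiv ℝ u x‖)) (t • h)
          rw [lintegral_congr e]
          simp
      _ ≤ 1 * ((∫⁻ x, ENNReal.ofReal (G ‖fderiv ℝ u x‖)) +
            ∫⁻ x, ENNReal.ofReal (G |u x|)) := by
          rw [one_mul]; exact le_self_add
      _ ≤ _ := by gcongr
  · rw [min_eq_left h1]
    have hpt : ∀ a b : ℝ, G (|a - b| / 1) ≤ K / 2 * G |a| + K / 2 * G |b| := by
      intro a b
      have e1 : G (|a - b| / 1) ≤ G (1/2 * (2 * |a|) + 1/2 * (2 * |b|)) := by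
        apply hmono _ _ (by positivity)
        have := abs_sub a b
        linarith
      have e2 := hConv.2 (mem_univ (2 * |a|)) (mem_univ (2 * |b|))
        (by norm_num : (0:ℝ) ≤ 1/2) (by norm_num : (0:ℝ) ≤ 1/2) (by norm_num)
      simp only [smul_eq_mul] at e2
      have e3 := hdbl |a| (abs_nonneg a)
      have e4 := hdbl |b| (abs_nonneg b)
      linarith
    have hm : Measurable (fun x => ENNReal.ofReal (G |u x|)) :=
      ENNReal.measurable_ofReal.comp (hc.comp huc.abs).measurable
    have hm' : Measurable (fun x => ENNReal.ofReal (G |u (x + h)|)) :=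
      hm.comp (measurable_add_const h)
    calc _ ≤ ∫⁻ x, (ENNReal.ofReal (K/2) * ENNReal.ofReal (G |u (x + h)|) +
              ENNReal.ofReal (K/2) * ENNReal.ofReal (G |u x|)) := by
          refine lintegral_mono fun x => ?_
          rw [← ENNReal.ofReal_mul (by positivity), ← ENNReal.ofReal_mul (by positivity),
            ← ENNReal.ofReal_add (mul_nonneg (by positivity) (hnn _))
              (mul_nonneg (by positivity) (hnn _))]
          exact ENNReal.ofReal_le_ofReal (hpt _ _)
      _ = ENNReal.ofReal K * ∫⁻ x, ENNReal.ofReal (G |u x|) := by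
          rw [lintegral_add_left (hm'.const_mul _), lintegral_const_mul _ hm',
            lintegral_const_mul _ hm,
            lintegral_add_right_eq_self (fun x => ENNReal.ofReal (G |u x|)) h, ← add_mul,
            ← ENNReal.ofReal_add (by positivity) (by positivity)]
          congr 2; ring
      _ ≤ _ := by gcongr; exact le_add_self

lemma weight_integrable (n : ℕ) (hn : n ≠ 0) (pm : ℝ) (M N : ℝ → ℝ)
    (hMpos : ∀ r > 0, 0 < M r)
    (hint0 : IntegrableOn
      (fun r : ℝ => r ^ ((n : ℝ) - 1 + pm) / (N r * M r ^ pm)) (Ioo 0 1))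
    (hint1 : IntegrableOn
      (fun r : ℝ => r ^ ((n : ℝ) - 1) / (N r * M r ^ pm)) (Ioi 1)) :
    Integrable (fun h : EuclideanSpace ℝ (Fin n) => (min 1 ‖h‖ / M ‖h‖) ^ pm / N ‖h‖) := by
  have : Nonempty (Fin n) := ⟨⟨0, Nat.pos_of_ne_zero hn⟩⟩
  have : Nontrivial (EuclideanSpace ℝ (Fin n)) := inferInstance
  have hcast : ∀ r : ℝ, r ^ (n - 1) = r ^ ((n : ℝ) - 1) := by
    intro r
    rw [← Real.rpow_natCast, Nat.cast_sub (Nat.one_le_iff_ne_zero.2 hn), Nat.cast_one]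
  refine (integrable_fun_norm_addHaar volume
    (f := fun r : ℝ => (min 1 r / M r) ^ pm / N r)).2 ?_
  rw [finrank_euclideanSpace_fin]
  rw [← Ioo_union_Ici_eq_Ioi (zero_lt_one' ℝ)]
  refine IntegrableOn.union ?_ ?_
  · refine hint0.congr_fun (fun r hr => ?_) measurableSet_Ioo
    simp only [smul_eq_mul]
    rw [min_eq_right hr.2.le, Real.div_rpow hr.1.le (hMpos r hr.1).le, hcast,
      Real.rpow_add hr.1, div_div, mul_div_assoc, mul_comm (N r)]
  · rw [integrableOn_Ici_iff_integrableOn_Ioi]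
    refine hint1.congr_fun (fun r hr => ?_) measurableSet_Ioi
    have hr0 : (0:ℝ) < r := zero_lt_one.trans hr
    simp only [smul_eq_mul]
    rw [min_eq_left (le_of_lt hr), Real.div_rpow zero_le_one (hMpos r hr0).le, hcast,
      Real.one_rpow, div_div, mul_one_div, mul_comm (N r)]

lemma lintegral_shear_le {E : Type*} [NormedAddCommGroup E] [MeasurableSpace E] [BorelSpace E]
    [SecondCountableTopology E] (μ : Measure E) [SFinite μ] [μ.IsAddLeftInvariant]
    (f : E × E → ℝ≥0∞) :
    ∫⁻ p, f p ∂(μ.prod μ) ≤ ∫⁻ h, ∫⁻ x, f (x, x + h) ∂μ ∂μ := by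
  have hmp := measurePreserving_prod_add_swap μ μ
  have hemb : MeasurableEmbedding (fun z : E × E => (z.2, z.2 + z.1)) :=
    (MeasurableEquiv.prodComm.trans (MeasurableEquiv.shearAddRight E)).measurableEmbedding
  rw [← hmp.lintegral_comp_emb hemb]
  exact lintegral_prod_le _

theorem sobolev_subset_fractional_orlicz
    (n : ℕ)
    (G g : ℝ → ℝ) (pm pp : ℝ)
    (hEven : ∀ t, G (-t) = G t)
    (hConv : ConvexOn ℝ univ G)
    (hMono : StrictMonoOn G (Ioi 0))
    (hG0 : G 0 = 0)
    (hderiv : ∀ t > 0, HasDerivAt G (g t) t)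
    (hp : 1 < pm) (hpm : pm ≤ pp)
    (hgrowth : ∀ t > 0, pm ≤ t * g t / G t ∧ t * g t / G t ≤ pp)
    (M N : ℝ → ℝ)
    (hMmono : MonotoneOn M (Ioi 0)) (hNmono : MonotoneOn N (Ioi 0))
    (hMpos : ∀ r > 0, 0 < M r) (hNpos : ∀ r > 0, 0 < N r)
    (hMlow : ∀ r > 0, min 1 r ≤ M r) (hNcont : ContinuousOn N (Ioi 0))
    (hint0 : IntegrableOn
      (fun r : ℝ => r ^ ((n : ℝ) - 1 + pm) / (N r * M r ^ pm)) (Ioo 0 1))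
    (hint1 : IntegrableOn
      (fun r : ℝ => r ^ ((n : ℝ) - 1) / (N r * M r ^ pm)) (Ioi 1)) :
    ∃ C > 0, ∀ u : EuclideanSpace ℝ (Fin n) → ℝ,
      ContDiff ℝ 2 u → HasCompactSupport u →
      (∫⁻ p : EuclideanSpace ℝ (Fin n) × EuclideanSpace ℝ (Fin n),
          ENNReal.ofReal (G (|u p.1 - u p.2| / M ‖p.1 - p.2‖)) /
            ENNReal.ofReal (N ‖p.1 - p.2‖)) ≤
      ENNReal.ofReal C *
        ((∫⁻ x, ENNReal.ofReal (G ‖fderiv ℝ u x‖)) +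
          ∫⁻ x, ENNReal.ofReal (G |u x|)) := by
  rcases eq_or_ne n 0 with rfl | hn
  · refine ⟨1, one_pos, fun u _ _ => ?_⟩
    have : ∀ p : EuclideanSpace ℝ (Fin 0) × EuclideanSpace ℝ (Fin 0),
        ENNReal.ofReal (G (|u p.1 - u p.2| / M ‖p.1 - p.2‖)) /
            ENNReal.ofReal (N ‖p.1 - p.2‖) = 0 := by
      intro p
      rw [Subsingleton.elim p.1 p.2]
      simp [hG0]
    simp only [this, lintegral_zero]
    exact zero_le
  have hnn := young_nonneg G hEven hConv hG0
  have hpos : ∀ t > 0, 0 < G t := fun t ht => young_pos G hEven hConv hMono hG0 ht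
  have hmono : ∀ s t, 0 ≤ s → s ≤ t → G s ≤ G t :=
    fun s t hs hst => young_mono G hEven hConv hMono hG0 hs hst
  have hc := young_cont G hConv
  have hK : (1:ℝ) ≤ 2 ^ pp := Real.one_le_rpow one_le_two (by linarith)
  have hw := weight_integrable n hn pm M N hMpos hint0 hint1
  set w : EuclideanSpace ℝ (Fin n) → ℝ := fun h => (min 1 ‖h‖ / M ‖h‖) ^ pm / N ‖h‖ with hwdef
  set W : ℝ≥0∞ := ∫⁻ h, ENNReal.ofReal (w h) with hWdef
  have hW : W ≠ ⊤ := by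
    refine ne_top_of_le_ne_top hw.2.ne (lintegral_mono fun h => ?_)
    exact Real.ofReal_le_enorm _
  have hWK : W ≤ ENNReal.ofReal (W.toReal + 1) := by
    rw [ENNReal.le_ofReal_iff_toReal_le hW (by positivity)]
    linarith
  refine ⟨(W.toReal + 1) * 2 ^ pp, by positivity, fun u hu _ => ?_⟩
  set S : ℝ≥0∞ := (∫⁻ x, ENNReal.ofReal (G ‖fderiv ℝ u x‖)) +
          ∫⁻ x, ENNReal.ofReal (G |u x|) with hS
  have hinner : ∀ h : EuclideanSpace ℝ (Fin n),
      ∫⁻ x, ENNReal.ofReal (G (|u x - u (x + h)| / M ‖x - (x + h)‖)) /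
            ENNReal.ofReal (N ‖x - (x + h)‖) ≤
        ENNReal.ofReal (w h) * (ENNReal.ofReal (2 ^ pp) * S) := by
    intro h
    rcases eq_or_ne h 0 with rfl | hh
    · simp [hG0]
    have hr : 0 < ‖h‖ := norm_pos_iff.2 hh
    have hM := hMpos _ hr
    have hN := hNpos _ hr
    have hmin : 0 < min 1 ‖h‖ := lt_min one_pos hr
    have hpt : ∀ x, ENNReal.ofReal (G (|u x - u (x + h)| / M ‖x - (x + h)‖)) /
            ENNReal.ofReal (N ‖x - (x + h)‖) ≤
          ENNReal.ofReal (w h) * ENNReal.ofReal (G (|u (x + h) - u x| / min 1 ‖h‖)) := by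
      intro x
      have e : ‖x - (x + h)‖ = ‖h‖ := by simp
      rw [e, abs_sub_comm, ← ENNReal.ofReal_div_of_pos hN, ← ENNReal.ofReal_mul (by positivity)]
      apply ENNReal.ofReal_le_ofReal
      have h1 := young_scale_le G g pm hpos hG0 hderiv (fun t ht => (hgrowth t ht).1)
        (c := min 1 ‖h‖ / M ‖h‖) (t := |u (x + h) - u x| / min 1 ‖h‖) (by positivity)
        ((div_le_one hM).2 (hMlow _ hr)) (by positivity)
      have e2 : min 1 ‖h‖ / M ‖h‖ * (|u (x + h) - u x| / min 1 ‖h‖) =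
          |u (x + h) - u x| / M ‖h‖ := by
        field_simp
      rw [e2] at h1
      rw [hwdef, div_mul_eq_mul_div]
      gcongr
    refine (lintegral_mono hpt).trans ?_
    rw [lintegral_const_mul' _ _ ENNReal.ofReal_ne_top]
    gcongr
    exact translation_bound G hnn hmono hConv hc (2 ^ pp) hK
      (fun t ht => young_double G g pp hpos hG0 hderiv (fun t ht => (hgrowth t ht).2) ht)
      u hu h hh
  refine (lintegral_shear_le volume _).trans ((lintegral_mono hinner).trans ?_)
  rw [lintegral_mul_const'' _ hw.1.aemeasurable.ennreal_ofReal, ← hWdef,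
    ENNReal.ofReal_mul (by positivity), mul_assoc]
  gcongr
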